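/- arXiv:2604.20509 — 2 statements merged into one kernel-verified Lean document; each statement's English description precedes it below -/
import Mathlib

section
/- Let Y ⊆ ℝ^p and X_y = {x ∈ ℝ^n : h(x) ∈ Y}. Suppose Σ is m-related to Σ′ on Y, i.e., there is a differentiable map m : ℝ^n → ℝ^n̂ such that for every u ∈ ℝ^m and every x ∈ X_y there exists v ∈ ℝ^m̂ with Dm(x)(f(x,u)) = φ(m(x), v) and h(x) = κ(m(x)). Then for every open interval ℓ ⊆ ℝ, every input function u : ℓ → ℝ^m, and every differentiable trajectory x : ℓ → ℝ^n with x′(t) = f(x(t), u(t)) and h(x(t)) ∈ Y for all t ∈ ℓ, there exists a function v : ℓ → ℝ^m̂ such that the curve ξ := m ∘ x satisfies ξ′(t) = φ(ξ(t), v(t)) and κ(ξ(t)) = h(x(t)) for all t ∈ ℓ; in particular, every output trajectory of Σ taking values in Y is also an output trajectory of Σ′. -/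
/-- `ℝ^k` as a Euclidean space. -/
abbrev Euc (k : ℕ) := EuclideanSpace ℝ (Fin k)

/-- if `Σ` is `m`-related to `Σ′` on `Y`, then every output trajectory of `Σ`
taking values in `Y` is reproduced by `Σ′` along the curve `ξ = m ∘ x`. -/
theorem mRelation_output_match
    {n nh m mh p : ℕ}
    (f : Euc n → Euc m → Euc n) (h : Euc n → Euc p)
    (φ : Euc nh → Euc mh → Euc nh) (κ : Euc nh → Euc p)
    (Y : Set (Euc p))
    (mmap : Euc n → Euc nh) (hmdiff : Differentiable ℝ mmap)
    (hrel : ∀ (u : Euc m) (x : Euc n), h x ∈ Y →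
      ∃ v : Euc mh, fderiv ℝ mmap x (f x u) = φ (mmap x) v ∧ h x = κ (mmap x)) :
    ∀ ℓ : Set ℝ, IsOpen ℓ → ℓ.OrdConnected →
    ∀ u : ℝ → Euc m, ∀ x : ℝ → Euc n,
    (∀ t ∈ ℓ, HasDerivAt x (f (x t) (u t)) t) →
    (∀ t ∈ ℓ, h (x t) ∈ Y) →
    ∃ v : ℝ → Euc mh, ∀ t ∈ ℓ,
      HasDerivAt (fun s => mmap (x s)) (φ (mmap (x t)) (v t)) t ∧
      κ (mmap (x t)) = h (x t) := by
  intro ℓ _ _ u x hx hY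
  have hv : ∀ t, ∃ v : Euc mh, t ∈ ℓ →
      fderiv ℝ mmap (x t) (f (x t) (u t)) = φ (mmap (x t)) v ∧ h (x t) = κ (mmap (x t)) := by
    intro t
    by_cases ht : t ∈ ℓ
    · obtain ⟨v, hv⟩ := hrel (u t) (x t) (hY t ht)
      exact ⟨v, fun _ => hv⟩
    · exact ⟨0, fun ht' => absurd ht' ht⟩
  choose v hv using hv
  refine ⟨v, fun t ht => ⟨?_, (hv t ht).2.symm⟩⟩
  rw [← (hv t ht).1]
  exact (hmdiff (x t)).hasFDerivAt.comp_hasDerivAt t (hx t ht)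
end

section
/- Suppose f(x,u) = f̄(x) + g(x)u and φ(ξ,v) = φ̄(ξ) + δ(ξ)v, where g(x) : ℝ^m → ℝ^n and δ(ξ) : ℝ^m̂ → ℝ^n̂ are linear maps for each x and ξ. Assume: (1) h is Lipschitz with constant L_h > 0; (2) there exist a function k : ℝ^n × ℝ^n × ℝ^m → ℝ^m, a differentiable function V : ℝ^n × ℝ^n → ℝ, and class-K∞ functions α̲, ᾱ, α such that for all x, z ∈ ℝ^n and u ∈ ℝ^m: α̲(‖x−z‖) ≤ V(x,z) ≤ ᾱ(‖x−z‖) and D₁V(x,z)(f(x,u)) + D₂V(x,z)(f(z, k(z,x,u))) ≤ −α(‖x−z‖); (3) there exist a set V ⊆ ℝ^n̂ and differentiable maps p : ℝ^n̂ → ℝ^n and l : ℝ^n̂ → ℝ^m such that for all ξ ∈ V: Dp(ξ)(φ̄(ξ)) = f̄(p(ξ)) + g(p(ξ))(l(ξ)) and κ(ξ) = h(p(ξ)); (4) there exist a class-K∞ function α*, a class-K function γ, and a function u* : V × ℝ^n × ℝ^m̂ → ℝ^m such that α_d := α − α* is of class K∞ and |D₁V(p(ξ),x)(Dp(ξ)(δ(ξ)v))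 + D₂V(p(ξ),x)(g(x)(u*(ξ,x,v)))| ≤ α*(‖p(ξ)−x‖) + γ(‖v‖) for all ξ ∈ V, x ∈ ℝ^n, v ∈ ℝ^m̂. Define W(ξ,x) := V(p(ξ),x) and u_w(ξ,x,v) := k(x, p(ξ), l(ξ)) + u*(ξ,x,v). Then for all ξ ∈ V, x ∈ ℝ^n, v ∈ ℝ^m̂: (i) W(ξ,x) ≥ α̲(‖κ(ξ) − h(x)‖ / L_h), and (ii) D₁V(p(ξ),x)(Dp(ξ)(φ(ξ,v))) + D₂V(p(ξ),x)(f(x, u_w(ξ,x,v))) ≤ −α_d(ᾱ⁻¹(W(ξ,x))) + γ(‖v‖), where ᾱ⁻¹ is the inverse of ᾱ on [0,∞). -/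
/-- A class-`K` function: continuous, strictly increasing on `[0,∞)`, and vanishing at `0`. -/
def ClassK (γ : ℝ → ℝ) : Prop :=
  ContinuousOn γ (Set.Ici 0) ∧ StrictMonoOn γ (Set.Ici 0) ∧ γ 0 = 0

/-- A class-`K∞` function: class `K` and tending to `∞` at `∞`. -/
def ClassKInf (γ : ℝ → ℝ) : Prop :=
  ClassK γ ∧ Filter.Tendsto γ Filter.atTop Filter.atTop

/-- construction of a local simulation function `W(ξ,x) = V(p(ξ),x)` and
interface `u_w(ξ,x,v) = k(x,p(ξ),l(ξ)) + u*(ξ,x,v)` for input-affine systems. -/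
theorem simulation_function_design
    {n nh m mh p : ℕ}
    (fbar : Euc n → Euc n) (g : Euc n → (Euc m →L[ℝ] Euc n))
    (φbar : Euc nh → Euc nh) (δ : Euc nh → (Euc mh →L[ℝ] Euc nh))
    (h : Euc n → Euc p) (κ : Euc nh → Euc p)
    -- (1) h Lipschitz with constant L_h > 0
    (L_h : ℝ) (hL : 0 < L_h)
    (hLip : ∀ x z : Euc n, ‖h x - h z‖ ≤ L_h * ‖x - z‖)
    -- (2) stabilisability Lyapunov function
    (k : Euc n → Euc n → Euc m → Euc m)
    (V : Euc n × Euc n → ℝ) (hVdiff : Differentiable ℝ V)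
    (αlow αbar α : ℝ → ℝ)
    (hαlow : ClassKInf αlow) (hαbar : ClassKInf αbar) (hα : ClassKInf α)
    (hVlow : ∀ x z : Euc n, αlow ‖x - z‖ ≤ V (x, z))
    (hVup : ∀ x z : Euc n, V (x, z) ≤ αbar ‖x - z‖)
    (hVdecr : ∀ (x z : Euc n) (u : Euc m),
      fderiv ℝ V (x, z) (fbar x + g x u, 0)
        + fderiv ℝ V (x, z) (0, fbar z + g z (k z x u)) ≤ -α ‖x - z‖)
    -- (3) invariance equations on the set Vs
    (Vs : Set (Euc nh))
    (pmap : Euc nh → Euc n) (l : Euc nh → Euc m)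
    (hpdiff : Differentiable ℝ pmap) (hldiff : Differentiable ℝ l)
    (hinv : ∀ ξ ∈ Vs, fderiv ℝ pmap ξ (φbar ξ) = fbar (pmap ξ) + g (pmap ξ) (l ξ))
    (hκ : ∀ ξ ∈ Vs, κ ξ = h (pmap ξ))
    -- (4) condition (B)
    (αstar γ : ℝ → ℝ) (ustar : Euc nh → Euc n → Euc mh → Euc m)
    (hαstar : ClassKInf αstar) (hγ : ClassK γ)
    (hαd : ClassKInf fun r => α r - αstar r)
    (hB : ∀ ξ ∈ Vs, ∀ (x : Euc n) (v : Euc mh),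
      |fderiv ℝ V (pmap ξ, x) (fderiv ℝ pmap ξ (δ ξ v), 0)
        + fderiv ℝ V (pmap ξ, x) (0, g x (ustar ξ x v))|
        ≤ αstar ‖pmap ξ - x‖ + γ ‖v‖)
    -- inverse of ᾱ on [0,∞)
    (αbarInv : ℝ → ℝ)
    (hαbarInv : ∀ r ∈ Set.Ici (0:ℝ), αbarInv (αbar r) = r ∧ αbar (αbarInv r) = r) :
    ∀ ξ ∈ Vs, ∀ (x : Euc n) (v : Euc mh),
      -- (i) lower bound of W(ξ,x) = V(p(ξ),x)
      (αlow (‖κ ξ - h x‖ / L_h) ≤ V (pmap ξ, x)) ∧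
      -- (ii) decrease condition along the interconnected dynamics
      (fderiv ℝ V (pmap ξ, x) (fderiv ℝ pmap ξ (φbar ξ + δ ξ v), 0)
        + fderiv ℝ V (pmap ξ, x) (0, fbar x + g x (k x (pmap ξ) (l ξ) + ustar ξ x v))
        ≤ -(α (αbarInv (V (pmap ξ, x))) - αstar (αbarInv (V (pmap ξ, x)))) + γ ‖v‖) := by
  intro ξ hξ x v
  have hr : 0 ≤ ‖pmap ξ - x‖ := norm_nonneg _
  have hquot : 0 ≤ ‖κ ξ - h x‖ / L_h := by positivity
  refine ⟨?_, ?_⟩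
  · refine le_trans (hαlow.1.2.1.monotoneOn hquot hr ?_) (hVlow _ _)
    rw [div_le_iff₀' hL, hκ ξ hξ]
    exact hLip _ _
  · have hW : 0 ≤ V (pmap ξ, x) := by
      have hmono := hαlow.1.2.1.monotoneOn (Set.mem_Ici.2 le_rfl) hr hr
      rw [hαlow.1.2.2] at hmono
      exact hmono.trans (hVlow _ _)
    obtain ⟨s, hs, hsW⟩ : V (pmap ξ, x) ∈ αbar '' Set.Icc 0 ‖pmap ξ - x‖ := by
      refine intermediate_value_Icc hr (hαbar.1.1.mono Set.Icc_subset_Ici_self) ⟨?_, hVup _ _⟩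
      rwa [hαbar.1.2.2]
    have hinvW : αbarInv (V (pmap ξ, x)) = s := by
      rw [← hsW]
      exact (hαbarInv s hs.1).1
    have hαd_le := hαd.1.2.1.monotoneOn hs.1 hr hs.2
    have hdecr := hVdecr (pmap ξ) x (l ξ)
    have hinput := (abs_le.1 (hB ξ hξ x v)).2
    have hfst : ((fderiv ℝ pmap ξ (φbar ξ + δ ξ v), 0) : Euc n × Euc n)
        = (fbar (pmap ξ) + g (pmap ξ) (l ξ), 0) + (fderiv ℝ pmap ξ (δ ξ v), 0) := by
      rw [map_add, hinv ξ hξ, Prod.mk_add_mk, add_zero]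
    have hsnd : ((0, fbar x + g x (k x (pmap ξ) (l ξ) + ustar ξ x v)) : Euc n × Euc n)
        = (0, fbar x + g x (k x (pmap ξ) (l ξ))) + (0, g x (ustar ξ x v)) := by
      rw [map_add, Prod.mk_add_mk, add_zero, add_assoc]
    rw [hfst, hsnd, map_add, map_add, hinvW]
    linarith
end
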